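/- arXiv:2604.26154 — 4 statements merged into one kernel-verified Lean document; each statement's English description precedes it below -/
import Mathlib

section
/- Let H be a complex Hilbert space, let F : H → H be a compact bounded linear operator, and let r > 0 be a real number. If F − F* = i r F* F, where F* denotes the Hilbert adjoint of F, then the operator I + i r F is unitary, i.e. (I + i r F)*(I + i r F) = (I + i r F)(I + i r F)* = I. -/
open ContinuousLinearMap Complex

/-- An injective compact perturbation of the identity is invertible. -/
theorem IsCompactOperator.isUnit_one_add_of_injective
    {𝕜 E : Type*} [NontriviallyNormedField 𝕜] [NormedAddCommGroup E] [NormedSpace 𝕜 E]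
    [CompleteSpace E] {K : E →L[𝕜] E} (hK : IsCompactOperator K)
    (hinj : Function.Injective (1 + K : E →L[𝕜] E)) : IsUnit (1 + K) := by
  rcases hK.hasEigenvalue_or_mem_resolventSet (neg_ne_zero.2 (one_ne_zero (α := 𝕜))) with h | h
  · obtain ⟨x, hx⟩ := h.exists_hasEigenvector
    have hKx : K x = -x := by simpa using hx.apply_eq_smul
    exact absurd (hinj (a₁ := x) (a₂ := 0) (by simp [hKx])) hx.2
  · rw [spectrum.mem_resolventSet_iff] at h
    convert h.neg using 1
    simp [add_comm]

/-- A continuous endomorphism with a left inverse is injective. -/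
theorem injective_of_mul_eq_one
    {𝕜 E : Type*} [Semiring 𝕜] [TopologicalSpace E] [AddCommMonoid E] [Module 𝕜 E]
    {S T : E →L[𝕜] E} (h : S * T = 1) : Function.Injective T :=
  Function.LeftInverse.injective (g := S) fun x => DFunLike.congr_fun h x

/-- If `F` is a compact operator on a complex Hilbert space and `r > 0` satisfies
`F - F* = i r F* F`, then `I + i r F` is unitary. -/
theorem one_add_i_r_F_unitary
    {H : Type*} [NormedAddCommGroup H] [InnerProductSpace ℂ H] [CompleteSpace H]
    (F : H →L[ℂ] H) (hFcompact : IsCompactOperator F)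
    (r : ℝ) (hr : 0 < r)
    (hid : F - adjoint F = (Complex.I * r) • ((adjoint F) ∘L F)) :
    (1 + (Complex.I * r) • F) ∈ unitary (H →L[ℂ] H) := by
  have hisom : star (1 + (Complex.I * r) • F) * (1 + (Complex.I * r) • F) = 1 := by
    have hid' : F - star F = (Complex.I * r) • (star F * F) := hid
    have hconj : star (Complex.I * (r : ℂ)) = -(Complex.I * r) := by simp
    rw [star_add, star_one, star_smul, hconj]
    calc (1 + -(Complex.I * r) • star F) * (1 + (Complex.I * r) • F)
        = 1 + (Complex.I * r) • (F - star F - (Complex.I * r) • (star F * F)) := by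
          simp only [add_mul, mul_add, one_mul, mul_one, smul_mul_smul_comm]
          module
      _ = 1 := by simp [hid']
  have hinj := injective_of_mul_eq_one hisom
  have hunit := (hFcompact.smul (Complex.I * (r : ℂ))).isUnit_one_add_of_injective
    (K := (Complex.I * r) • F) hinj
  exact Unitary.mem_iff.2 ⟨hisom, hunit.mul_right_cancel <| by rw [mul_assoc, hisom, mul_one, one_mul]⟩
end

section
/- For every real t > 0, one has ∫₀^∞ e^{−t y} · y/(1 + y²) dy ≤ √π / √t. -/
open MeasureTheory Real Set

lemma div_one_add_sq_le_rpow_neg_half {y : ℝ} (hy : 0 < y) :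
    y / (1 + y ^ 2) ≤ y ^ (-(1 / 2) : ℝ) := by
  rw [rpow_neg hy.le, ← sqrt_eq_rpow, ← one_div, div_le_div_iff₀ (by positivity) (by positivity)]
  have h := sq_sqrt hy.le
  nlinarith [sq_nonneg (√y - 1), sq_nonneg (y - √y)]

/-- For `t > 0`, `∫₀^∞ e^{-t y} y/(1+y²) dy ≤ √π / √t`. -/
theorem integral_exp_mul_div_one_add_sq_le (t : ℝ) (ht : 0 < t) :
    ∫ y in Ioi (0 : ℝ), Real.exp (-t * y) * (y / (1 + y ^ 2)) ≤
      Real.sqrt π / Real.sqrt t := by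
  have hint : IntegrableOn (fun y : ℝ => y ^ (-(1 / 2) : ℝ) * exp (-t * y)) (Ioi 0) := by
    simpa only [rpow_one] using
      integrableOn_rpow_mul_exp_neg_mul_rpow (p := 1) (s := -(1 / 2)) (by norm_num) one_pos ht
  calc ∫ y in Ioi (0 : ℝ), exp (-t * y) * (y / (1 + y ^ 2))
      ≤ ∫ y in Ioi (0 : ℝ), y ^ (-(1 / 2) : ℝ) * exp (-t * y) := by
        refine integral_mono_of_nonneg ?_ hint ?_
        · filter_upwards [ae_restrict_mem measurableSet_Ioi] with y (hy : 0 < y)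
          simp only [Pi.zero_apply]
          positivity
        · filter_upwards [ae_restrict_mem measurableSet_Ioi] with y (hy : 0 < y)
          rw [mul_comm]
          gcongr
          exact div_one_add_sq_le_rpow_neg_half hy
    _ = √π / √t := by
        have h := integral_rpow_mul_exp_neg_mul_Ioi (a := 1 / 2) (r := t) (by norm_num) ht
        rw [Gamma_one_half_eq, ← sqrt_eq_rpow, sqrt_div zero_le_one, sqrt_one] at h
        rw [div_eq_mul_one_div √π, mul_comm √π, ← h]
        norm_num
end

section
/- Let s ∈ (0, 1/2) and a > 0. Then ∫₀^∞ e^{−a y} · y^{2s} sin(sπ) / (y^{4s} + 1 − 2 cos(sπ) y^{2s}) dy ≤ (Γ(1 − 2s) / sin(sπ)) · a^{2s−1}, where Γ denotes the Gamma function. -/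
open MeasureTheory Real Set

lemma sin_sq_mul_sq_le (θ t : ℝ) :
    Real.sin θ ^ 2 * t ^ 2 ≤ t ^ 2 + 1 - 2 * Real.cos θ * t := by
  nlinarith [sq_nonneg (Real.cos θ * t - 1), Real.sin_sq_add_cos_sq θ]

lemma mul_sin_div_le {θ t : ℝ} (hθ : 0 < Real.sin θ) (ht : 0 < t) :
    t * Real.sin θ / (t ^ 2 + 1 - 2 * Real.cos θ * t) ≤ t⁻¹ / Real.sin θ := by
  calc t * Real.sin θ / (t ^ 2 + 1 - 2 * Real.cos θ * t)
      ≤ t * Real.sin θ / (Real.sin θ ^ 2 * t ^ 2) := by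
        gcongr
        exact sin_sq_mul_sq_le θ t
    _ = t⁻¹ / Real.sin θ := by field_simp

/-- For `s ∈ (0, 1/2)` and `a > 0`,
`∫₀^∞ e^{-a y} y^{2s} sin(sπ)/(y^{4s} + 1 - 2 cos(sπ) y^{2s}) dy
  ≤ (Γ(1-2s)/sin(sπ)) a^{2s-1}`. -/
theorem integral_remainder_bound_s_lt_half (s : ℝ) (hs : s ∈ Set.Ioo (0 : ℝ) (1 / 2))
    (a : ℝ) (ha : 0 < a) :
    ∫ y in Ioi (0 : ℝ),
        Real.exp (-a * y) * y ^ (2 * s) * Real.sin (s * π) /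
          (y ^ (4 * s) + 1 - 2 * Real.cos (s * π) * y ^ (2 * s)) ≤
      (Real.Gamma (1 - 2 * s) / Real.sin (s * π)) * a ^ (2 * s - 1) := by
  obtain ⟨hs0, hs1⟩ := hs
  have hsin : 0 < Real.sin (s * π) :=
    Real.sin_pos_of_pos_of_lt_pi (by positivity) (by nlinarith [Real.pi_pos])
  have hr : 0 < 1 - 2 * s := by linarith
  have hΓ := Real.Gamma_pos_of_pos hr
  have key := Real.integral_rpow_mul_exp_neg_mul_Ioi hr ha
  have hint : IntegrableOn (fun y : ℝ ↦ y ^ (1 - 2 * s - 1) * Real.exp (-(a * y))) (Ioi 0) :=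
    .of_integral_ne_zero (by rw [key]; positivity)
  have hpow (y : ℝ) (hy : 0 < y) : y ^ (4 * s) = (y ^ (2 * s)) ^ 2 := by
    rw [← Real.rpow_mul_natCast hy.le]
    congr 1
    push_cast
    ring
  calc _ ≤ ∫ y in Ioi (0 : ℝ),
        y ^ (1 - 2 * s - 1) * Real.exp (-(a * y)) / Real.sin (s * π) := by
        refine integral_mono_of_nonneg ?_ (hint.div_const _) ?_
        · filter_upwards [ae_restrict_mem measurableSet_Ioi] with y hy
          have hy : 0 < y := hy
          have hQ := sin_sq_mul_sq_le (s * π) (y ^ (2 * s))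
          rw [← hpow y hy] at hQ
          have hQ0 := le_trans (by positivity) hQ
          simp only [Pi.zero_apply]
          positivity
        · filter_upwards [ae_restrict_mem measurableSet_Ioi] with y hy
          have hy : 0 < y := hy
          have h := mul_le_mul_of_nonneg_left
            (mul_sin_div_le hsin (Real.rpow_pos_of_pos hy (2 * s))) (Real.exp_pos (-a * y)).le
          rw [← hpow y hy, ← Real.rpow_neg hy.le] at h
          rw [show 1 - 2 * s - 1 = -(2 * s) by ring, ← neg_mul a y]
          calc _ = Real.exp (-a * y) * (y ^ (2 * s) * Real.sin (s * π) /
                (y ^ (4 * s) + 1 - 2 * Real.cos (s * π) * y ^ (2 * s))) := by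
                rw [mul_assoc, mul_div_assoc]
            _ ≤ _ := h
            _ = _ := by rw [mul_comm, div_mul_eq_mul_div]
    _ = _ := by
        rw [integral_div, key, one_div, Real.inv_rpow ha.le, ← Real.rpow_neg ha.le, neg_sub]
        ring
end

section
/- For s ∈ (0,1) and k > 0 define φ_{s,k}(t) := (k^{1−2s}/π) ∫₀^∞ e^{−y t k} · y^{2s} sin(sπ) / (y^{4s} + 1 − 2 cos(sπ) y^{2s}) dy for t > 0. Then for every R > 0 there exists a constant C = C(s, R) > 0 such that for all k > 0: ∫₀^R φ_{s,k}(t) dt ≤ C (1 + k^{−s} + k^{1−2s}). -/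
open MeasureTheory Real Set

/-- The remainder `Φ^Δ_{s,k}` of the one-dimensional fractional Helmholtz fundamental
solution, evaluated at `t = |x|`. -/
noncomputable def phiDeltaOneDim (s k t : ℝ) : ℝ :=
  (k ^ (1 - 2 * s) / π) *
    ∫ y in Ioi (0 : ℝ),
      Real.exp (-(y * t * k)) * y ^ (2 * s) * Real.sin (s * π) /
        (y ^ (4 * s) + 1 - 2 * Real.cos (s * π) * y ^ (2 * s))

lemma exp_neg_le_rpow_sub_one {s x : ℝ} (hs : s ∈ Ioo (0 : ℝ) 1) (hx : 0 < x) :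
    Real.exp (-x) ≤ x ^ (s - 1) := by
  have h : x ^ (1 - s) ≤ Real.exp x := by
    rcases le_total x 1 with h1 | h1
    · exact (rpow_le_one hx.le h1 (by linarith [hs.2])).trans (one_le_exp hx.le)
    · calc x ^ (1 - s) ≤ x ^ (1 : ℝ) := rpow_le_rpow_of_exponent_le h1 (by linarith [hs.1])
        _ = x := rpow_one x
        _ ≤ Real.exp x := by linarith [add_one_le_exp x]
  rw [show s - 1 = -(1 - s) by ring, rpow_neg hx.le, Real.exp_neg]
  exact inv_anti₀ (rpow_pos_of_pos hx _) h

lemma one_sub_abs_mul_le_quadratic (c : ℝ) {u : ℝ} (hu : 0 ≤ u) :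
    (1 - |c|) * (u ^ 2 + 1) ≤ u ^ 2 + 1 - 2 * c * u := by
  nlinarith [mul_nonneg (abs_nonneg c) (sq_nonneg (u - 1)),
    mul_le_mul_of_nonneg_right (le_abs_self c) hu]

lemma abs_cos_mul_pi_lt_one {s : ℝ} (hs : s ∈ Ioo (0 : ℝ) 1) : |Real.cos (s * π)| < 1 := by
  have hsin : 0 < Real.sin (s * π) :=
    sin_pos_of_pos_of_lt_pi (mul_pos hs.1 pi_pos) (by nlinarith [pi_pos, hs.2])
  rw [← sq_lt_one_iff_abs_lt_one]
  nlinarith [Real.sin_sq_add_cos_sq (s * π)]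

/-- A function comparable to `y ^ (s - 1) * min (y ^ (2 * s)) (y ^ (-(2 * s)))`. -/
noncomputable def kernelMajorant (s y : ℝ) : ℝ :=
  if y ≤ 1 then y ^ (3 * s - 1) else y ^ (-s - 1)

lemma kernelMajorant_nonneg {s y : ℝ} (hy : 0 < y) : 0 ≤ kernelMajorant s y := by
  unfold kernelMajorant
  split_ifs <;> positivity

lemma integrableOn_kernelMajorant {s : ℝ} (hs : 0 < s) :
    IntegrableOn (kernelMajorant s) (Ioi 0) := by
  rw [← Ioc_union_Ioi_eq_Ioi (zero_le_one' ℝ)]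
  refine IntegrableOn.union ?_ ?_
  · have h : IntegrableOn (fun y : ℝ => y ^ (3 * s - 1)) (Ioc 0 1) :=
      (intervalIntegrable_iff_integrableOn_Ioc_of_le zero_le_one).1
        (intervalIntegral.intervalIntegrable_rpow' (by linarith))
    refine h.congr_fun (fun y hy => ?_) measurableSet_Ioc
    simp [kernelMajorant, hy.2]
  · have h := integrableOn_Ioi_rpow_of_lt (show -s - 1 < -1 by linarith) one_pos
    refine h.congr_fun (fun y hy => ?_) measurableSet_Ioi
    simp [kernelMajorant, not_le.2 (mem_Ioi.1 hy)]

lemma rpow_mul_div_le_kernelMajorant {s y : ℝ} (hy : 0 < y) :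
    y ^ (s - 1) * (y ^ (2 * s) / ((y ^ (2 * s)) ^ 2 + 1)) ≤ kernelMajorant s y := by
  have hu : 0 < y ^ (2 * s) := rpow_pos_of_pos hy _
  unfold kernelMajorant
  split_ifs with h
  · rw [show 3 * s - 1 = (s - 1) + 2 * s by ring, rpow_add hy]
    gcongr
    exact div_le_self hu.le (by nlinarith)
  · rw [show -s - 1 = (s - 1) + -(2 * s) by ring, rpow_add hy, rpow_neg hy.le]
    gcongr
    rw [div_le_iff₀ (by positivity), inv_mul_eq_div, le_div_iff₀ hu]
    nlinarith

lemma phiDelta_denominator_ge {s y : ℝ} (hy : 0 < y) :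
    (1 - |Real.cos (s * π)|) * ((y ^ (2 * s)) ^ 2 + 1) ≤
      y ^ (4 * s) + 1 - 2 * Real.cos (s * π) * y ^ (2 * s) := by
  have h : y ^ (4 * s) = (y ^ (2 * s)) ^ 2 := by
    rw [← rpow_natCast, ← rpow_mul hy.le]
    congr 1
    push_cast
    ring
  rw [h]
  exact one_sub_abs_mul_le_quadratic _ (rpow_nonneg hy.le _)

lemma phiDelta_integrand_nonneg {s : ℝ} (hs : s ∈ Ioo (0 : ℝ) 1) (a : ℝ) {y : ℝ} (hy : 0 < y) :
    0 ≤ Real.exp a * y ^ (2 * s) * Real.sin (s * π) /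
      (y ^ (4 * s) + 1 - 2 * Real.cos (s * π) * y ^ (2 * s)) := by
  have hsin : 0 ≤ Real.sin (s * π) :=
    sin_nonneg_of_nonneg_of_le_pi (mul_nonneg hs.1.le pi_pos.le) (by nlinarith [pi_pos, hs.2])
  have hc : 0 < 1 - |Real.cos (s * π)| := sub_pos.2 (abs_cos_mul_pi_lt_one hs)
  have hD := le_trans (by positivity) (phiDelta_denominator_ge (s := s) hy)
  positivity

lemma phiDelta_integrand_le {s k t : ℝ} (hs : s ∈ Ioo (0 : ℝ) 1) (hk : 0 < k) (ht : 0 < t)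
    {y : ℝ} (hy : 0 < y) :
    Real.exp (-(y * t * k)) * y ^ (2 * s) * Real.sin (s * π) /
        (y ^ (4 * s) + 1 - 2 * Real.cos (s * π) * y ^ (2 * s)) ≤
      (t * k) ^ (s - 1) * (1 - |Real.cos (s * π)|)⁻¹ * kernelMajorant s y := by
  have hc : 0 < 1 - |Real.cos (s * π)| := sub_pos.2 (abs_cos_mul_pi_lt_one hs)
  have hexp : Real.exp (-(y * t * k)) ≤ y ^ (s - 1) * (t * k) ^ (s - 1) := by
    rw [← mul_rpow hy.le (by positivity), ← mul_assoc]
    exact exp_neg_le_rpow_sub_one hs (by positivity)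
  calc
    _ ≤ (y ^ (s - 1) * (t * k) ^ (s - 1)) * y ^ (2 * s) * 1 /
        ((1 - |Real.cos (s * π)|) * ((y ^ (2 * s)) ^ 2 + 1)) := by
      refine div_le_div₀ (by positivity) ?_ (by positivity) (phiDelta_denominator_ge hy)
      refine (mul_le_mul_of_nonneg_left (sin_le_one _) (by positivity)).trans ?_
      gcongr
    _ = (t * k) ^ (s - 1) * (1 - |Real.cos (s * π)|)⁻¹ *
        (y ^ (s - 1) * (y ^ (2 * s) / ((y ^ (2 * s)) ^ 2 + 1))) := by
      field_simp
    _ ≤ _ := by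
      gcongr
      exact rpow_mul_div_le_kernelMajorant hy

lemma phiDeltaOneDim_nonneg {s k : ℝ} (hs : s ∈ Ioo (0 : ℝ) 1) (hk : 0 < k) (t : ℝ) :
    0 ≤ phiDeltaOneDim s k t :=
  mul_nonneg (by positivity)
    (setIntegral_nonneg measurableSet_Ioi fun _ hy => phiDelta_integrand_nonneg hs _ hy)

/-- The constant in the pointwise bound `phiDeltaOneDim_le`. -/
noncomputable def phiDeltaConst (s : ℝ) : ℝ :=
  π⁻¹ * (1 - |Real.cos (s * π)|)⁻¹ * ∫ y in Ioi (0 : ℝ), kernelMajorant s y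

lemma phiDeltaConst_nonneg {s : ℝ} (hs : s ∈ Ioo (0 : ℝ) 1) : 0 ≤ phiDeltaConst s := by
  have hc : 0 < 1 - |Real.cos (s * π)| := sub_pos.2 (abs_cos_mul_pi_lt_one hs)
  exact mul_nonneg (by positivity)
    (setIntegral_nonneg measurableSet_Ioi fun _ hy => kernelMajorant_nonneg hy)

lemma phiDeltaOneDim_le {s k t : ℝ} (hs : s ∈ Ioo (0 : ℝ) 1) (hk : 0 < k) (ht : 0 < t) :
    phiDeltaOneDim s k t ≤ phiDeltaConst s * k ^ (-s) * t ^ (s - 1) := by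
  have hint : (∫ y in Ioi (0 : ℝ), Real.exp (-(y * t * k)) * y ^ (2 * s) * Real.sin (s * π) /
        (y ^ (4 * s) + 1 - 2 * Real.cos (s * π) * y ^ (2 * s))) ≤
      (t * k) ^ (s - 1) * (1 - |Real.cos (s * π)|)⁻¹ *
        ∫ y in Ioi (0 : ℝ), kernelMajorant s y := by
    rw [← integral_const_mul]
    refine integral_mono_of_nonneg ?_ ((integrableOn_kernelMajorant hs.1).const_mul _) ?_
    · exact ae_restrict_of_forall_mem measurableSet_Ioi
        fun y hy => phiDelta_integrand_nonneg hs _ hy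
    · exact ae_restrict_of_forall_mem measurableSet_Ioi
        fun y hy => phiDelta_integrand_le hs hk ht hy
  refine (mul_le_mul_of_nonneg_left hint (by positivity)).trans_eq ?_
  rw [phiDeltaConst, mul_rpow ht.le hk.le, show -s = (1 - 2 * s) + (s - 1) by ring,
    rpow_add hk]
  ring

/-- `L¹` estimate for the `d = 1` remainder term: for `s ∈ (0,1)` and every `R > 0` there
is a constant `C = C(s,R) > 0` such that for all `k > 0`,
`∫₀^R Φ^Δ_{s,k}(t) dt ≤ C (1 + k^{-s} + k^{1-2s})`. -/
theorem phiDeltaOneDim_L1_bound (s : ℝ) (hs : s ∈ Set.Ioo (0 : ℝ) 1) (R : ℝ) (hR : 0 < R) :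
    ∃ C : ℝ, 0 < C ∧ ∀ k : ℝ, 0 < k →
      ∫ t in Ioc (0 : ℝ) R, phiDeltaOneDim s k t ≤
        C * (1 + k ^ (-s) + k ^ (1 - 2 * s)) := by
  have hpow : 0 ≤ ∫ t in Ioc (0 : ℝ) R, t ^ (s - 1) :=
    setIntegral_nonneg measurableSet_Ioc fun t ht => rpow_nonneg ht.1.le _
  have hC := mul_nonneg (phiDeltaConst_nonneg hs) hpow
  refine ⟨phiDeltaConst s * (∫ t in Ioc (0 : ℝ) R, t ^ (s - 1)) + 1, by linarith,
    fun k hk => ?_⟩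
  have hint : IntegrableOn (fun t : ℝ => t ^ (s - 1)) (Ioc 0 R) :=
    (intervalIntegrable_iff_integrableOn_Ioc_of_le hR.le).1
      (intervalIntegral.intervalIntegrable_rpow' (by linarith [hs.1]))
  calc
    _ ≤ ∫ t in Ioc (0 : ℝ) R, phiDeltaConst s * k ^ (-s) * t ^ (s - 1) :=
      integral_mono_of_nonneg (Filter.Eventually.of_forall (phiDeltaOneDim_nonneg hs hk))
        (hint.const_mul _)
        (ae_restrict_of_forall_mem measurableSet_Ioc fun t ht => phiDeltaOneDim_le hs hk ht.1)
    _ = phiDeltaConst s * (∫ t in Ioc (0 : ℝ) R, t ^ (s - 1)) * k ^ (-s) := by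
      rw [integral_const_mul]
      ring
    _ ≤ _ := by
      have h1 : 0 < k ^ (1 - 2 * s) := rpow_pos_of_pos hk _
      gcongr <;> linarith
end
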